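/- arXiv:2210.01910 — 4 statements merged into one kernel-verified Lean document; each statement's English description precedes it below -/
import Mathlib

section
/- Let β > 0, h > 0, and l ≥ 1 satisfy h·e^{βh} > (l−1)·e^{−1}/β. If x : Fin l → ℝ satisfies max_i x_i = h, then the softmax average s(β,x) = (Σ_i x_i e^{β x_i}) / (Σ_i e^{β x_i}) is strictly positive. -/
/-- The softmax approximation of the maximum:
`s(β, x) = (∑ i, x i * exp (β * x i)) / (∑ i, exp (β * x i))`. -/
noncomputable def softmax {l : ℕ} (β : ℝ) (x : Fin l → ℝ) : ℝ :=
  (∑ i, x i * Real.exp (β * x i)) / (∑ i, Real.exp (β * x i))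

/-- The function `y ↦ y * exp (β * y)` is bounded below by its value at `y = -1 / β`. -/
theorem neg_exp_neg_one_div_le_mul_exp {β : ℝ} (hβ : 0 < β) (y : ℝ) :
    -(Real.exp (-1) / β) ≤ y * Real.exp (β * y) := by
  have h := mul_le_mul_of_nonneg_right (Real.add_one_le_exp (-1 - β * y))
    (Real.exp_pos (β * y)).le
  rw [← Real.exp_add, sub_add_cancel] at h
  rw [← neg_div, div_le_iff₀ hβ]
  linarith

/-- If `β > 0`, `h > 0`, `l ≥ 1` satisfy `h * exp (β * h) > (l - 1) * exp (-1) / β`, and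
`x : Fin l → ℝ` has maximum equal to `h`, then the softmax average is strictly positive. -/
theorem softmax_pos (β h : ℝ) (hβ : 0 < β) (hh : 0 < h) (l : ℕ) (hl : 1 ≤ l)
    (hcond : h * Real.exp (β * h) > ((l : ℝ) - 1) * Real.exp (-1) / β)
    (x : Fin l → ℝ) (hmax : IsGreatest (Set.range x) h) :
    0 < softmax β x := by
  obtain ⟨⟨i₀, hi₀⟩, -⟩ := hmax
  refine div_pos ?_ (Finset.sum_pos (fun i _ => Real.exp_pos _) ⟨i₀, Finset.mem_univ _⟩)
  rw [← Finset.add_sum_erase _ _ (Finset.mem_univ i₀), hi₀]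
  have hrest := Finset.card_nsmul_le_sum (Finset.univ.erase i₀)
    (fun i => x i * Real.exp (β * x i)) _
    (fun i _ => neg_exp_neg_one_div_le_mul_exp hβ (x i))
  rw [Finset.card_erase_of_mem (Finset.mem_univ i₀), Finset.card_univ, Fintype.card_fin,
    nsmul_eq_mul, Nat.cast_sub hl, Nat.cast_one] at hrest
  rw [mul_div_assoc] at hcond
  linarith
end

section
/- There exist l ≥ 1, β > 0, and x : Fin l → ℝ such that max_i x_i > 0 but the softmax average s(β,x) = (Σ_i x_i e^{β x_i}) / (Σ_i e^{β x_i}) is strictly negative. Hence the ordinary softmax approximation of the maximum is not sound. -/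
/-- There exist `l ≥ 1`, `β > 0`, and `x : Fin l → ℝ` with `max_i x i > 0` but
`s(β, x) < 0`: the ordinary softmax approximation of the maximum is not sound. -/
theorem softmax_not_sound :
    ∃ (l : ℕ) (hl : 1 ≤ l) (β : ℝ) (x : Fin l → ℝ),
      0 < β ∧ 0 < Finset.univ.sup' ⟨⟨0, hl⟩, Finset.mem_univ _⟩ x ∧ softmax β x < 0 := by
  refine ⟨2, one_le_two, 1 / 6, ![1, -2], by norm_num, ?_, ?_⟩
  · exact (Finset.lt_sup'_iff _).2 ⟨0, Finset.mem_univ _, by simp⟩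
  · refine div_neg_of_neg_of_pos ?_ (Finset.sum_pos (fun i _ => Real.exp_pos _) ⟨0, Finset.mem_univ _⟩)
    have hsplit : Real.exp (1 / 6 * 1) = Real.exp (1 / 2) * Real.exp (1 / 6 * -2) := by
      rw [← Real.exp_add]
      norm_num
    have hsq : Real.exp (1 / 2) * Real.exp (1 / 2) = Real.exp 1 := by
      rw [← Real.exp_add]
      norm_num
    have hlt : Real.exp (1 / 2) < 2 := by
      nlinarith [Real.exp_one_lt_three, Real.exp_pos (1 / 2)]
    simp only [Fin.sum_univ_two, Matrix.cons_val_zero, Matrix.cons_val_one]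
    rw [hsplit]
    nlinarith [Real.exp_pos (1 / 6 * -2)]
end

section
/- Let l ≥ 1, r : Fin l → ℝ, w : Fin l → {0,1} a binary indicator vector whose selected set S = {i : w_i = 1} is nonempty, β ∈ ℝ, h > 0, and ε ≥ 0 with |max_j (r_j w_j)| + ε > 0. If r_i < 0 for every i ∈ S, then F(r,β,h,w) < 0. -/
/-- The sparse softmax function `F(r, β, h, w)`: with `r'_i = r_i * w_i`,
`r''_i = h * r'_i / (|max_j r'_j| + ε)` and `q_i = exp (β * r''_i) / ∑_j exp (β * r''_j)`,
it is `(∑_i r_i * w_i * q_i) / (∑_i w_i * q_i)`. -/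
noncomputable def sparseSoftmax {l : ℕ} (r : Fin l → ℝ) (β h ε : ℝ) (w : Fin l → ℝ) : ℝ :=
  let r' : Fin l → ℝ := fun i => r i * w i
  let m : ℝ := ⨆ i, r' i
  let r'' : Fin l → ℝ := fun i => h * r' i / (|m| + ε)
  let q : Fin l → ℝ := fun i => Real.exp (β * r'' i) / ∑ j, Real.exp (β * r'' j)
  (∑ i, r i * w i * q i) / (∑ i, w i * q i)

/-- A weighted mean of values that are negative wherever the indicator weight is selected, taken
with positive coefficients, is negative. -/
theorem weighted_mean_neg_of_neg_on_support {ι : Type*} [Fintype ι] {r w q : ι → ℝ}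
    (hw : ∀ i, w i = 0 ∨ w i = 1) (hS : ∃ i, w i = 1) (hq : ∀ i, 0 < q i)
    (hneg : ∀ i, w i = 1 → r i < 0) :
    (∑ i, r i * w i * q i) / (∑ i, w i * q i) < 0 := by
  obtain ⟨i₀, hi₀⟩ := hS
  apply div_neg_of_neg_of_pos
  · refine Finset.sum_neg' (fun i _ => ?_) ⟨i₀, Finset.mem_univ _, ?_⟩
    · rcases hw i with h | h
      · simp [h]
      · simpa [h] using (mul_neg_of_neg_of_pos (hneg i h) (hq i)).le
    · simpa [hi₀] using mul_neg_of_neg_of_pos (hneg i₀ hi₀) (hq i₀)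
  · refine Finset.sum_pos' (fun i _ => ?_) ⟨i₀, Finset.mem_univ _, ?_⟩
    · rcases hw i with h | h
      · simp [h]
      · simpa [h] using (hq i).le
    · simpa [hi₀] using hq i₀

/-- Case (s1) of soundness: if every selected entry is negative, then the sparse softmax
value is negative. -/
theorem sparseSoftmax_neg_of_all_neg (l : ℕ) (hl : 1 ≤ l)
    (r : Fin l → ℝ) (w : Fin l → ℝ) (hw : ∀ i, w i = 0 ∨ w i = 1)
    (hS : ∃ i, w i = 1) (β h ε : ℝ) (hh : 0 < h) (hε : 0 ≤ ε)
    (hden : 0 < |⨆ j, r j * w j| + ε)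
    (hneg : ∀ i, w i = 1 → r i < 0) :
    sparseSoftmax r β h ε w < 0 := by
  have : Nonempty (Fin l) := ⟨⟨0, hl⟩⟩
  refine weighted_mean_neg_of_neg_on_support hw hS (fun i => ?_) hneg
  exact div_pos (Real.exp_pos _)
    (Finset.sum_pos (fun j _ => Real.exp_pos _) Finset.univ_nonempty)
end

section
/- Let l ≥ 1, r : Fin l → ℝ, w : Fin l → {0,1} a binary indicator vector whose selected set S = {i : w_i = 1} is nonempty, and take ε = 0. Suppose β > 0 and h > 0 satisfy h·e^{βh} > (l−1)·e^{−1}/β. If max_{i∈S} r_i > 0, then F(r,β,h,w) > 0. -/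
/-- The function `u ↦ u * exp u` attains its minimum `-exp (-1)` at `u = -1`. -/
theorem neg_exp_neg_one_le_mul_exp (u : ℝ) : -Real.exp (-1) ≤ u * Real.exp u := by
  have h1 : -u ≤ Real.exp (-u - 1) := by linarith [Real.add_one_le_exp (-u - 1)]
  have h2 : Real.exp (-u - 1) * Real.exp u = Real.exp (-1) := by
    rw [← Real.exp_add]
    congr 1
    ring
  nlinarith [mul_le_mul_of_nonneg_right h1 (Real.exp_pos u).le]

/-- If `x k = m > 0` and `exp c` exceeds `(l - 1) * exp (-1) / c`, then the exponentially
weighted sum of the `x i` is positive. -/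
theorem sum_mul_exp_pos {l : ℕ} (x : Fin l → ℝ) (k : Fin l) {c m : ℝ} (hc : 0 < c) (hm : 0 < m)
    (hk : x k = m) (hcond : ((l : ℝ) - 1) * Real.exp (-1) < c * Real.exp c) :
    0 < ∑ i, x i * Real.exp (c * (x i / m)) := by
  have hterm : ∀ i, 0 ≤ c / m * (x i * Real.exp (c * (x i / m))) + Real.exp (-1) := by
    intro i
    have h := neg_exp_neg_one_le_mul_exp (c * (x i / m))
    have e : c / m * (x i * Real.exp (c * (x i / m)))
        = c * (x i / m) * Real.exp (c * (x i / m)) := by ring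
    linarith
  have hsingle := Finset.single_le_sum (fun i _ => hterm i) (Finset.mem_univ k)
  rw [Finset.sum_add_distrib, ← Finset.mul_sum] at hsingle
  simp only [hk, div_self hm.ne', mul_one, Finset.sum_const, Finset.card_univ, Fintype.card_fin,
    nsmul_eq_mul] at hsingle
  have e : c / m * (m * Real.exp c) = c * Real.exp c := by field_simp
  rw [e] at hsingle
  have hpos : 0 < c / m * ∑ i, x i * Real.exp (c * (x i / m)) := by linarith
  exact pos_of_mul_pos_right hpos (div_pos hc hm).le

/-- Case (s2) of soundness: with `ε = 0`, `β > 0`, `h > 0` and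
`h * exp (β * h) > (l - 1) * exp (-1) / β`, if the maximum of the selected entries is
positive, then the sparse softmax value is positive. -/
theorem sparseSoftmax_pos_of_max_pos (l : ℕ) (hl : 1 ≤ l)
    (r : Fin l → ℝ) (w : Fin l → ℝ) (hw : ∀ i, w i = 0 ∨ w i = 1)
    (hS : ∃ i, w i = 1) (β h : ℝ) (hβ : 0 < β) (hh : 0 < h)
    (hcond : h * Real.exp (β * h) > ((l : ℝ) - 1) * Real.exp (-1) / β)
    (hmax : 0 < sSup (r '' {i | w i = 1})) :
    0 < sparseSoftmax r β h 0 w := by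
  obtain ⟨i₀, hi₀⟩ := hS
  obtain ⟨_, ⟨j, hj, rfl⟩, hrj⟩ :=
    exists_lt_of_lt_csSup (Set.Nonempty.image r ⟨i₀, hi₀⟩) hmax
  have hj : w j = 1 := hj
  have : Nonempty (Fin l) := ⟨j⟩
  obtain ⟨k, hk⟩ := exists_eq_ciSup_of_finite (f := fun i => r i * w i)
  have hm : 0 < ⨆ i, r i * w i := by
    have h := le_ciSup (Set.finite_range fun i => r i * w i).bddAbove j
    simp only [hj, mul_one] at h
    linarith
  unfold sparseSoftmax
  simp only [add_zero, abs_of_pos hm]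
  generalize (⨆ i, r i * w i) = m at hk hm ⊢
  have hZ : 0 < ∑ j, Real.exp (β * (h * (r j * w j) / m)) :=
    Finset.sum_pos (fun _ _ => Real.exp_pos _) Finset.univ_nonempty
  apply div_pos
  · have hc : ((l : ℝ) - 1) * Real.exp (-1) < β * h * Real.exp (β * h) := by
      rw [gt_iff_lt, div_lt_iff₀ hβ] at hcond
      linarith
    have hsum := sum_mul_exp_pos (fun i => r i * w i) k (mul_pos hβ hh) hm hk hc
    have e : ∀ i, β * h * (r i * w i / m) = β * (h * (r i * w i) / m) := fun i => by ring
    simp only [e] at hsum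
    simp only [← mul_div_assoc, ← Finset.sum_div] at hsum hZ ⊢
    exact div_pos hsum hZ
  · refine Finset.sum_pos' (fun i _ => ?_) ⟨j, Finset.mem_univ j, ?_⟩
    · have hwi : 0 ≤ w i := by rcases hw i with h | h <;> simp [h]
      positivity
    · rw [hj]
      positivity
end
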